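/- For real parameters with β ≠ 0 and γ ≠ 0: the form-J_II noise matrix N_III is zero if and only if (α/β)²·a3 + (α/β)·a2 + a1 = 0, and the matrix T_III is symplectic (T_III·Ω·T_IIIᵀ = Ω) if and only if α·η = β·γ. In particular, if a1 = a2 = a3 = 0 and α·η = β·γ, the pair (T_III, N_III) represents a Gaussian unitary. -/

import Mathlib

open Matrix

/-- The one-mode symplectic form `Ω = !![0, 1; -1, 0]`. -/
noncomputable def Omega : Matrix (Fin 2) (Fin 2) ℝ := !![0, 1; -1, 0]

theorem mul_Omega_mul_transpose (M : Matrix (Fin 2) (Fin 2) ℝ) :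
    M * Omega * Mᵀ = M.det • Omega := by
  ext i j
  fin_cases i <;> fin_cases j <;>
    simp [Omega, Matrix.mul_apply, Fin.sum_univ_two, Matrix.det_fin_two] <;> ring

/-- A real `2 × 2` matrix is symplectic iff its determinant is `1`. -/
theorem mul_Omega_mul_transpose_eq_iff (M : Matrix (Fin 2) (Fin 2) ℝ) :
    M * Omega * Mᵀ = Omega ↔ M.det = 1 := by
  rw [mul_Omega_mul_transpose]
  refine ⟨fun h => ?_, fun h => by rw [h, one_smul]⟩
  simpa [Omega] using congrFun (congrFun h 0) 1

/-- For `β ≠ 0`, `γ ≠ 0`: the form-`J_II` noise matrix `N_III` vanishes iff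
`(α/β)²·a3 + (α/β)·a2 + a1 = 0`, and `T_III` is symplectic iff `α·η = β·γ`.
In particular, if `a1 = a2 = a3 = 0` and `α·η = β·γ` the pair `(T_III, N_III)`
represents a Gaussian unitary. -/
theorem stmt_15 (α β γ η a1 a2 a3 b1 b2 b3 b4 : ℝ) (hβ : β ≠ 0) (hγ : γ ≠ 0) :
    (let φ : ℝ := α / β * (η / γ) * b3 + α / β * b4 + η / γ * b1 + b2
     let T_III : Matrix (Fin 2) (Fin 2) ℝ := !![-η / γ, 0; φ, -α / β]
     let P11 : ℝ := -((α / β) ^ 2 * a3 + α / β * a2 + a1)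
     let N_III : Matrix (Fin 2) (Fin 2) ℝ := !![0, 0; 0, -2 * P11]
     (N_III = 0 ↔ (α / β) ^ 2 * a3 + α / β * a2 + a1 = 0) ∧
     (T_III * Omega * T_IIIᵀ = Omega ↔ α * η = β * γ) ∧
     (a1 = 0 → a2 = 0 → a3 = 0 → α * η = β * γ →
        N_III = 0 ∧ T_III * Omega * T_IIIᵀ = Omega)) := by
  intro φ T_III P11 N_III
  have hN : N_III = 0 ↔ (α / β) ^ 2 * a3 + α / β * a2 + a1 = 0 := by
    have hN' : N_III = 0 ↔ -2 * P11 = 0 := by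
      refine ⟨fun h => congrFun (congrFun h 1) 1, fun h => ?_⟩
      ext i j
      fin_cases i <;> fin_cases j <;> simp [N_III] <;> linarith
    rw [hN']
    constructor <;> intro h <;> simp only [P11] at * <;> linarith
  have hT : T_III * Omega * T_IIIᵀ = Omega ↔ α * η = β * γ := by
    have hdet : T_III.det = α * η / (β * γ) := by
      simp only [T_III, Matrix.det_fin_two_of]
      field_simp
      ring
    rw [mul_Omega_mul_transpose_eq_iff, hdet, div_eq_one_iff_eq (mul_ne_zero hβ hγ)]
  refine ⟨hN, hT, fun h1 h2 h3 h => ⟨hN.2 ?_, hT.2 h⟩⟩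
  rw [h1, h2, h3]
  ring
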